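/- Frame correspondence for Ĉn: let F = (W, R) be a frame with a single binary relation R, and interpret Cφ at s as truth of φ at all R-successors of s. Then the schema Ĉn — (⋀_{1≤i≤n+1} Ĉφ_i) → Ĉ(⋁_{1≤i<j≤n+1}(Ĉφ_i ∧ Ĉφ_j)) — is valid on F (true at every state under every valuation and every choice of the φ_i) if and only if F satisfies the first-order condition: for all x, y_1, …, y_{n+1}, if R x y_i for every 1 ≤ i ≤ n+1, then there exists z with R x z and R z y_i ∧ R z y_j for some 1 ≤ i < j ≤ n+1. -/

import Mathlib

/-- Formulas of the language `L_C`: atoms, negation, conjunction, common belief `C`. -/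
inductive Formula : Type where
  | atom : ℕ → Formula
  | neg  : Formula → Formula
  | and  : Formula → Formula → Formula
  | box  : Formula → Formula

namespace Formula

/-- Implication `φ → ψ` as a derived connective. -/
def imp (φ ψ : Formula) : Formula := neg (and φ (neg ψ))

/-- Disjunction `φ ∨ ψ` as a derived connective. -/
def or (φ ψ : Formula) : Formula := neg (and (neg φ) (neg ψ))

/-- The diamond `Ĉφ = ¬C¬φ`. -/
def dia (φ : Formula) : Formula := neg (box (neg φ))

/-- A fixed contradiction (used as the empty disjunction). -/
def bot : Formula := and (atom 0) (neg (atom 0))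

/-- A fixed tautology (used as the empty conjunction). -/
def top : Formula := neg bot

end Formula

/-- Finite disjunction of a list of formulas. -/
def bigOr (l : List Formula) : Formula := l.foldr Formula.or Formula.bot

/-- Finite conjunction of a list of formulas. -/
def bigAnd (l : List Formula) : Formula := l.foldr Formula.and Formula.top

/-- The list of pairs `(i, j)` with `i < j` in `Fin m`. -/
def pairs (m : ℕ) : List (Fin m × Fin m) :=
  ((List.finRange m).product (List.finRange m)).filter (fun p => decide (p.1 < p.2))

/-- A Kripke model for `n` agents. -/
structure Model (n : ℕ) where
  W : Type
  nonempty : Nonempty W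
  R : Fin n → W → W → Prop
  V : ℕ → W → Prop

/-- `R*`: the transitive closure of the union of the agents' relations. -/
def Model.star {n : ℕ} (M : Model n) : M.W → M.W → Prop :=
  Relation.TransGen (fun x y => ∃ i, M.R i x y)

/-- Satisfaction: `C` quantifies over `R*`-successors. -/
def Sat {n : ℕ} (M : Model n) : M.W → Formula → Prop
  | s, .atom p => M.V p s
  | s, .neg φ => ¬ Sat M s φ
  | s, .and φ ψ => Sat M s φ ∧ Sat M s ψ
  | s, .box φ => ∀ t, M.star s t → Sat M t φ

/-- A relation is serial if every point has a successor. -/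
def Serial {W : Type} (R : W → W → Prop) : Prop := ∀ x, ∃ y, R x y

/-- A relation is Euclidean if `R x y` and `R x z` imply `R y z`. -/
def Euclidean {W : Type} (R : W → W → Prop) : Prop := ∀ x y z, R x y → R x z → R y z

/-- A KD45 model: all agents' relations are serial, transitive and Euclidean. -/
def KD45 {n : ℕ} (M : Model n) : Prop :=
  ∀ i, Serial (M.R i) ∧ Transitive (M.R i) ∧ Euclidean (M.R i)

/-- `φ` is an instance of a propositional tautology: it is true under every
assignment of truth values to formulas that respects negation and conjunction. -/
def Tautology (φ : Formula) : Prop :=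
  ∀ v : Formula → Prop,
    (∀ ψ, v ψ.neg ↔ ¬ v ψ) →
    (∀ ψ χ, v (ψ.and χ) ↔ (v ψ ∧ v χ)) →
    v φ

/-- The axiom `Cn`: `(C ⋀_{i<j}(Cφᵢ ∨ Cφⱼ)) → ⋁_i Cφᵢ`, for `n+1` formulas. -/
def CnAx (n : ℕ) (φ : Fin (n + 1) → Formula) : Formula :=
  ((bigAnd ((pairs (n + 1)).map (fun p => Formula.or ((φ p.1).box) ((φ p.2).box)))).box).imp
    (bigOr ((List.finRange (n + 1)).map (fun i => (φ i).box)))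

/-- The axiom `Ĉn`: `(⋀_i Ĉφᵢ) → Ĉ(⋁_{i<j}(Ĉφᵢ ∧ Ĉφⱼ))`, for `n+1` formulas. -/
def CHatNAx (n : ℕ) (φ : Fin (n + 1) → Formula) : Formula :=
  (bigAnd ((List.finRange (n + 1)).map (fun i => (φ i).dia))).imp
    ((bigOr ((pairs (n + 1)).map (fun p => ((φ p.1).dia).and ((φ p.2).dia)))).dia)

/-- Satisfaction on a uni-modal frame with relation `R` and valuation `V`:
`C` quantifies over `R`-successors. -/
def SatR {W : Type} (R : W → W → Prop) (V : ℕ → W → Prop) : W → Formula → Prop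
  | s, .atom p => V p s
  | s, .neg φ => ¬ SatR R V s φ
  | s, .and φ ψ => SatR R V s φ ∧ SatR R V s ψ
  | s, .box φ => ∀ t, R s t → SatR R V t φ

section SatR

variable {W : Type} {R : W → W → Prop} {V : ℕ → W → Prop} {s : W}

theorem satR_imp {φ ψ : Formula} :
    SatR R V s (φ.imp ψ) ↔ (SatR R V s φ → SatR R V s ψ) := by
  simp [Formula.imp, SatR]

theorem satR_or {φ ψ : Formula} :
    SatR R V s (φ.or ψ) ↔ (SatR R V s φ ∨ SatR R V s ψ) := by
  simp only [Formula.or, SatR]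
  tauto

theorem satR_dia {φ : Formula} :
    SatR R V s φ.dia ↔ ∃ t, R s t ∧ SatR R V t φ := by
  simp [Formula.dia, SatR]

theorem satR_bigOr {l : List Formula} :
    SatR R V s (bigOr l) ↔ ∃ φ ∈ l, SatR R V s φ := by
  induction l with
  | nil => simp [bigOr, Formula.bot, SatR]
  | cons φ l ih =>
    have hcons : bigOr (φ :: l) = φ.or (bigOr l) := rfl
    simp [hcons, satR_or, ih]

theorem satR_bigAnd {l : List Formula} :
    SatR R V s (bigAnd l) ↔ ∀ φ ∈ l, SatR R V s φ := by
  induction l with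
  | nil => simp [bigAnd, Formula.top, Formula.bot, SatR]
  | cons φ l ih =>
    have hcons : bigAnd (φ :: l) = φ.and (bigAnd l) := rfl
    simp [hcons, SatR, ih]

theorem mem_pairs {m : ℕ} {p : Fin m × Fin m} : p ∈ pairs m ↔ p.1 < p.2 := by
  simp [pairs, List.product]

theorem satR_CHatNAx {n : ℕ} {φ : Fin (n + 1) → Formula} :
    SatR R V s (CHatNAx n φ) ↔
      ((∀ i, ∃ t, R s t ∧ SatR R V t (φ i)) →
        ∃ z, R s z ∧ ∃ i j : Fin (n + 1), i < j ∧
          (∃ t, R z t ∧ SatR R V t (φ i)) ∧ ∃ t, R z t ∧ SatR R V t (φ j)) := by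
  simp [CHatNAx, satR_imp, satR_bigAnd, satR_bigOr, satR_dia, mem_pairs, SatR]

end SatR

/-- Frame correspondence for `Ĉn`: the schema `Ĉn` is valid on a uni-modal frame
`(W, R)` iff for all `x, y₁, …, y_{n+1}` with `R x yᵢ` for all `i`, there is `z` with
`R x z` and `R z yᵢ`, `R z yⱼ` for some `i < j`. -/
theorem CHatN_frame_correspondence (n : ℕ) {W : Type} [Nonempty W]
    (R : W → W → Prop) :
    (∀ (V : ℕ → W → Prop) (s : W) (φ : Fin (n + 1) → Formula),
      SatR R V s (CHatNAx n φ)) ↔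
    (∀ (x : W) (y : Fin (n + 1) → W), (∀ i, R x (y i)) →
      ∃ z, R x z ∧ ∃ i j : Fin (n + 1), i < j ∧ R z (y i) ∧ R z (y j)) := by
  simp only [satR_CHatNAx]
  constructor
  · intro h x y hxy
    obtain ⟨z, hxz, i, j, hij, ⟨t, hzt, ht⟩, u, hzu, hu⟩ :=
      h (fun k w => ∃ i : Fin (n + 1), (i : ℕ) = k ∧ w = y i) x (fun i => .atom i)
        fun i => ⟨y i, hxy i, i, rfl, rfl⟩
    obtain ⟨a, ha, rfl⟩ := ht
    obtain ⟨b, hb, rfl⟩ := hu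
    obtain rfl := Fin.ext ha
    obtain rfl := Fin.ext hb
    exact ⟨z, hxz, a, b, hij, hzt, hzu⟩
  · intro h V s φ hφ
    choose y hy hsat using hφ
    obtain ⟨z, hsz, i, j, hij, hi, hj⟩ := h s y hy
    exact ⟨z, hsz, i, j, hij, ⟨y i, hi, hsat i⟩, y j, hj, hsat j⟩
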